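/- Let W be an xy-symmetric weight function on a measurable set Ω ⊆ ℝ² and let {Sₙ} be the MOPS of W on Ω. Suppose that for each n ≥ 0 and 0 ≤ k ≤ n there is a real bivariate polynomial r_{n,k} such that S_{2n+1,2k}(x,y) = x·r_{n,k}(x²,y²) for all (x,y). Then each r_{n,k} is monic with r_{n,k}(u,v) = u^{n−k} v^k + (terms of total degree < n), and the vectors R̂ₙ = (r_{n,0},…,r_{n,n})ᵀ form the MOPS of the weight W^{(1,0)} on Ω*: ∫_{Ω*} R̂ₙ(u,v) R̂ₘ(u,v)ᵀ W^{(1,0)}(u,v) du dv = 0 whenever n ≠ m. -/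

import Mathlib

noncomputable section

open MeasureTheory MvPolynomial

/-- Evaluation of a bivariate polynomial at a point of `ℝ × ℝ`. -/
def ev (p : ℝ × ℝ) (f : MvPolynomial (Fin 2) ℝ) : ℝ := eval ![p.1, p.2] f

/-- `W` is a weight function on the measurable set `Ω ⊆ ℝ²`: nonnegative and measurable,
positive on a set of positive Lebesgue measure, with all moments finite. -/
def IsWeight (Ω : Set (ℝ × ℝ)) (W : ℝ × ℝ → ℝ) : Prop :=
  MeasurableSet Ω ∧ Measurable W ∧ (∀ p ∈ Ω, 0 ≤ W p) ∧
    0 < volume {p | p ∈ Ω ∧ 0 < W p} ∧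
    ∀ h k : ℕ, IntegrableOn (fun p : ℝ × ℝ => p.1 ^ h * p.2 ^ k * W p) Ω

/-- `W` is an `xy`-symmetric weight on `Ω`: `Ω` is invariant under `(x,y) ↦ (-x,y)` and
`(x,y) ↦ (x,-y)`, and `W(-x,y) = W(x,y) = W(x,-y)` on `Ω`. -/
def XYSymmetric (Ω : Set (ℝ × ℝ)) (W : ℝ × ℝ → ℝ) : Prop :=
  (∀ p : ℝ × ℝ, p ∈ Ω → (-p.1, p.2) ∈ Ω ∧ (p.1, -p.2) ∈ Ω) ∧
    ∀ p ∈ Ω, W (-p.1, p.2) = W p ∧ W (p.1, -p.2) = W p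

/-- `f` is monic of the form `x^(n-j) y^j + (terms of total degree < n)`. -/
def MonicLead (n j : ℕ) (f : MvPolynomial (Fin 2) ℝ) : Prop :=
  f = X 0 ^ (n - j) * X 1 ^ j ∨ (f - X 0 ^ (n - j) * X 1 ^ j).totalDegree < n

/-- `P` is the monic orthogonal polynomial system (MOPS) of the weight `W` on `Ω`:
each `P n j` is monic with leading term `x^(n-j) y^j`, and vectors of different degrees
are mutually orthogonal. -/
def IsMOPS (Ω : Set (ℝ × ℝ)) (W : ℝ × ℝ → ℝ)
    (P : (n : ℕ) → Fin (n + 1) → MvPolynomial (Fin 2) ℝ) : Prop :=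
  (∀ (n : ℕ) (j : Fin (n + 1)), MonicLead n (j : ℕ) (P n j)) ∧
    ∀ m n : ℕ, m ≠ n → ∀ (i : Fin (m + 1)) (j : Fin (n + 1)),
      ∫ p in Ω, ev p (P m i) * ev p (P n j) * W p = 0

/-- The image domain `Ω* = {(u,v) : u ≥ 0, v ≥ 0, (√u, √v) ∈ Ω}`. -/
def Ωstar (Ω : Set (ℝ × ℝ)) : Set (ℝ × ℝ) :=
  {q | 0 ≤ q.1 ∧ 0 ≤ q.2 ∧ (Real.sqrt q.1, Real.sqrt q.2) ∈ Ω}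

/-- The weight `W^(0,0)(u,v) = (1/4) (uv)^(-1/2) W(√u, √v)` on `Ω*`. -/
def W00 (W : ℝ × ℝ → ℝ) : ℝ × ℝ → ℝ :=
  fun q => (1 / 4) * W (Real.sqrt q.1, Real.sqrt q.2) / Real.sqrt (q.1 * q.2)

lemma eq_X_mul_expand {f g : MvPolynomial (Fin 2) ℝ}
    (h : ∀ x y : ℝ, eval ![x, y] f = x * eval ![x ^ 2, y ^ 2] g) :
    f = X 0 * expand 2 g := by
  refine MvPolynomial.funext fun z => ?_
  have hz : z = ![z 0, z 1] := by ext i; fin_cases i <;> rfl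
  have hz2 : z ^ 2 = ![z 0 ^ 2, z 1 ^ 2] := by ext i; fin_cases i <;> rfl
  rw [map_mul, eval_X, eval_expand, hz2, ← h, ← hz]

lemma MonicLead.of_X_mul_expand {n k : ℕ} (hk : k ≤ n) {g : MvPolynomial (Fin 2) ℝ}
    (h : MonicLead (2 * n + 1) (2 * k) (X 0 * expand 2 g)) : MonicLead n k g := by
  have hX : (X 0 ^ (2 * n + 1 - 2 * k) * X 1 ^ (2 * k) : MvPolynomial (Fin 2) ℝ) =
      X 0 * expand 2 (X 0 ^ (n - k) * X 1 ^ k) := by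
    have hexp : 2 * n + 1 - 2 * k = 1 + 2 * (n - k) := by omega
    rw [hexp, map_mul, map_pow, map_pow, expand_X, expand_X, pow_add, pow_mul, pow_mul]
    ring
  have hX0 : (X 0 : MvPolynomial (Fin 2) ℝ) ≠ 0 := X_ne_zero 0
  rw [MonicLead, hX] at h
  rcases h with h | h
  · exact Or.inl (expand_injective two_pos (mul_left_cancel₀ hX0 h))
  · rw [← mul_sub, ← map_sub] at h
    by_cases hg : g - X 0 ^ (n - k) * X 1 ^ k = 0
    · exact Or.inl (sub_eq_zero.mp hg)
    · rw [totalDegree_mul_of_isDomain hX0 ((expand_ne_zero two_pos).mpr hg),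
        totalDegree_X, totalDegree_expand] at h
      exact Or.inr (by omega)

lemma IsWeight.integrableOn_ev_mul {Ω : Set (ℝ × ℝ)} {W : ℝ × ℝ → ℝ} (hW : IsWeight Ω W)
    (f : MvPolynomial (Fin 2) ℝ) : IntegrableOn (fun p => ev p f * W p) Ω := by
  induction f using MvPolynomial.induction_on' with
  | monomial u a =>
    refine ((hW.2.2.2.2 (u 0) (u 1)).const_mul a).congr (.of_forall fun p => ?_)
    simp [ev, eval_monomial, Finsupp.prod_fintype, mul_assoc]
  | add f g hf hg =>
    refine (hf.add hg).congr (.of_forall fun p => ?_)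
    simp [ev, add_mul]

/-- The integral over the plane of a function that is even in both variables is four times its
integral over the open first quadrant. -/
lemma integral_eq_four_mul_quadrant {G : ℝ × ℝ → ℝ} (hG : Integrable G)
    (heven : ∀ p : ℝ × ℝ, G (|p.1|, |p.2|) = G p) :
    ∫ p, G p = 4 * ∫ p in Set.Ioi (0 : ℝ) ×ˢ Set.Ioi (0 : ℝ), G p := by
  have hint : IntegrableOn G (Set.Ioi (0 : ℝ) ×ˢ Set.Ioi (0 : ℝ)) := hG.integrableOn
  rw [Measure.volume_eq_prod] at hG hint ⊢
  rw [integral_prod _ hG, setIntegral_prod _ hint]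
  have hinner (s : ℝ) : ∫ y, G (s, y) = 2 * ∫ y in Set.Ioi 0, G (s, y) := by
    rw [← integral_comp_abs (f := fun t => G (s, t))]
    refine integral_congr_ae (.of_forall fun y => ?_)
    simp [← heven (s, y), ← heven (s, |y|)]
  have houter : ∫ x, ∫ y, G (x, y) = 2 * ∫ x in Set.Ioi 0, ∫ y, G (x, y) := by
    rw [← integral_comp_abs (f := fun s => ∫ y, G (s, y))]
    refine integral_congr_ae (.of_forall fun x => integral_congr_ae (.of_forall fun y => ?_))
    simp [← heven (x, y), ← heven (|x|, y)]
  rw [houter]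
  simp only [hinner, integral_const_mul]
  ring

lemma hasFDerivAt_sq_prod (p : ℝ × ℝ) :
    HasFDerivAt (fun p : ℝ × ℝ => (p.1 ^ 2, p.2 ^ 2))
      (((2 * p.1) • ContinuousLinearMap.id ℝ ℝ).prodMap
        ((2 * p.2) • ContinuousLinearMap.id ℝ ℝ)) p := by
  have hsq (t : ℝ) :
      HasFDerivAt (fun t : ℝ => t ^ 2) ((2 * t) • ContinuousLinearMap.id ℝ ℝ) t := by
    refine ((hasDerivAt_pow 2 t).hasFDerivAt).congr_fderiv ?_
    ext
    simp
  exact (hsq p.1).prodMap p (hsq p.2)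

lemma det_smul_id_prodMap_smul_id (a b : ℝ) :
    ((a • ContinuousLinearMap.id ℝ ℝ).prodMap (b • ContinuousLinearMap.id ℝ ℝ)).det = a * b := by
  have h : ((a • ContinuousLinearMap.id ℝ ℝ).prodMap (b • ContinuousLinearMap.id ℝ ℝ) :
      ℝ × ℝ →ₗ[ℝ] ℝ × ℝ) = (a • LinearMap.id).prodMap (b • LinearMap.id) := rfl
  rw [ContinuousLinearMap.det, h, LinearMap.det_prodMap]
  simp

lemma Ωstar_ae_eq_image (Ω : Set (ℝ × ℝ)) :
    Ωstar Ω =ᵐ[volume]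
      (fun p : ℝ × ℝ => (p.1 ^ 2, p.2 ^ 2)) '' (Ω ∩ Set.Ioi (0 : ℝ) ×ˢ Set.Ioi (0 : ℝ)) := by
  have h1 : ∀ᵐ q : ℝ × ℝ, q.1 ≠ 0 :=
    Measure.quasiMeasurePreserving_fst.ae (Measure.ae_ne volume 0)
  have h2 : ∀ᵐ q : ℝ × ℝ, q.2 ≠ 0 :=
    Measure.quasiMeasurePreserving_snd.ae (Measure.ae_ne volume 0)
  filter_upwards [h1, h2] with q hq1 hq2
  refine propext ⟨fun ⟨h0, h0', hq⟩ => ⟨_, ⟨hq, ?_, ?_⟩, ?_⟩, ?_⟩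
  · exact Real.sqrt_pos.mpr (h0.lt_of_ne' hq1)
  · exact Real.sqrt_pos.mpr (h0'.lt_of_ne' hq2)
  · simp [Real.sq_sqrt h0, Real.sq_sqrt h0']
  · rintro ⟨p, ⟨hp, hp1, hp2⟩, rfl⟩
    refine ⟨sq_nonneg _, sq_nonneg _, ?_⟩
    simpa [Real.sqrt_sq (Set.mem_Ioi.mp hp1).le, Real.sqrt_sq (Set.mem_Ioi.mp hp2).le] using hp

lemma setIntegral_Ωstar_mul_W00 {Ω : Set (ℝ × ℝ)} (hΩ : MeasurableSet Ω) (W H : ℝ × ℝ → ℝ) :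
    ∫ q in Ωstar Ω, H q * W00 W q =
      ∫ p in Ω ∩ Set.Ioi (0 : ℝ) ×ˢ Set.Ioi (0 : ℝ), H (p.1 ^ 2, p.2 ^ 2) * W p := by
  have hs : MeasurableSet (Ω ∩ Set.Ioi (0 : ℝ) ×ˢ Set.Ioi (0 : ℝ)) :=
    hΩ.inter (measurableSet_Ioi.prod measurableSet_Ioi)
  have hinj : Set.InjOn (fun p : ℝ × ℝ => (p.1 ^ 2, p.2 ^ 2))
      (Ω ∩ Set.Ioi (0 : ℝ) ×ˢ Set.Ioi (0 : ℝ)) := by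
    rintro p ⟨-, hp1, hp2⟩ q ⟨-, hq1, hq2⟩ h
    rw [Prod.mk.injEq] at h
    exact Prod.ext ((pow_left_inj₀ (le_of_lt hp1) (le_of_lt hq1) two_ne_zero).mp h.1)
      ((pow_left_inj₀ (le_of_lt hp2) (le_of_lt hq2) two_ne_zero).mp h.2)
  rw [setIntegral_congr_set (Ωstar_ae_eq_image Ω),
    integral_image_eq_integral_abs_det_fderiv_smul volume hs
      (fun p _ => (hasFDerivAt_sq_prod p).hasFDerivWithinAt) hinj]
  refine setIntegral_congr_fun hs ?_
  rintro ⟨x, y⟩ ⟨-, hx, hy⟩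
  have hx : 0 < x := hx
  have hy : 0 < y := hy
  have hxy : √(x ^ 2 * y ^ 2) = x * y := by rw [← mul_pow, Real.sqrt_sq (by positivity)]
  simp only [det_smul_id_prodMap_smul_id, W00, smul_eq_mul, Real.sqrt_sq hx.le,
    Real.sqrt_sq hy.le, hxy, abs_of_pos (show 0 < 2 * x * (2 * y) by positivity)]
  field_simp
  ring

lemma XYSymmetric.abs_mem_iff {Ω : Set (ℝ × ℝ)} {W : ℝ × ℝ → ℝ} (h : XYSymmetric Ω W)
    (p : ℝ × ℝ) : (|p.1|, |p.2|) ∈ Ω ↔ p ∈ Ω := by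
  have h1 (a b : ℝ) : (-a, b) ∈ Ω ↔ (a, b) ∈ Ω :=
    ⟨fun hab => by simpa using (h.1 _ hab).1, fun hab => (h.1 _ hab).1⟩
  have h2 (a b : ℝ) : (a, -b) ∈ Ω ↔ (a, b) ∈ Ω :=
    ⟨fun hab => by simpa using (h.1 _ hab).2, fun hab => (h.1 _ hab).2⟩
  obtain ⟨x, y⟩ := p
  rcases abs_choice x with hx | hx <;> rcases abs_choice y with hy | hy <;>
    simp only [hx, hy, h1, h2]

lemma XYSymmetric.weight_abs {Ω : Set (ℝ × ℝ)} {W : ℝ × ℝ → ℝ} (h : XYSymmetric Ω W)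
    {p : ℝ × ℝ} (hp : p ∈ Ω) : W (|p.1|, |p.2|) = W p := by
  obtain ⟨x, y⟩ := p
  have hneg := (h.1 _ hp).2
  rcases abs_choice x with hx | hx <;> rcases abs_choice y with hy | hy <;>
    simp only [hx, hy]
  · exact (h.2 _ hp).2
  · exact (h.2 _ hp).1
  · exact (h.2 _ hneg).1.trans (h.2 _ hp).2

/-- If `{Sₙ}` is the MOPS of an `xy`-symmetric weight `W` on `Ω` and
`S_{2n+1,2k}(x,y) = x r_{n,k}(x²,y²)`, then the `r_{n,k}` are monic with leading
term `u^(n-k) v^k` and the vectors `(r_{n,0},…,r_{n,n})ᵀ` form the MOPS of the weight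
`W^(1,0)(u,v) = u W^(0,0)(u,v)` on `Ω*`. -/
theorem stmt9 (Ω : Set (ℝ × ℝ)) (W : ℝ × ℝ → ℝ) (hW : IsWeight Ω W)
    (hsym : XYSymmetric Ω W)
    (S : (n : ℕ) → Fin (n + 1) → MvPolynomial (Fin 2) ℝ) (hS : IsMOPS Ω W S)
    (r : (n : ℕ) → Fin (n + 1) → MvPolynomial (Fin 2) ℝ)
    (hrel : ∀ (n : ℕ) (k : Fin (n + 1)) (x y : ℝ),
      eval ![x, y] (S (2 * n + 1) ⟨2 * (k : ℕ), by have := k.isLt; omega⟩) =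
        x * eval ![x ^ 2, y ^ 2] (r n k)) :
    IsMOPS (Ωstar Ω) (fun z => z.1 * W00 W z) r := by
  have hS_eq (n : ℕ) (k : Fin (n + 1)) := eq_X_mul_expand (hrel n k)
  refine ⟨fun n k => ?_, fun m n hmn i j => ?_⟩
  · have h := hS.1 (2 * n + 1) ⟨2 * (k : ℕ), by have := k.isLt; omega⟩
    rw [hS_eq] at h
    exact h.of_X_mul_expand (Nat.le_of_lt_succ k.isLt)
  have hzero := hS.2 (2 * m + 1) (2 * n + 1) (by omega)
    ⟨2 * (i : ℕ), by have := i.isLt; omega⟩ ⟨2 * (j : ℕ), by have := j.isLt; omega⟩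
  have hint := hW.integrableOn_ev_mul (S (2 * m + 1) ⟨2 * (i : ℕ), by have := i.isLt; omega⟩ *
    S (2 * n + 1) ⟨2 * (j : ℕ), by have := j.isLt; omega⟩)
  set H : ℝ × ℝ → ℝ := fun q => ev q (r m i) * ev q (r n j) * q.1 with hH
  have hHS (p : ℝ × ℝ) : H (p.1 ^ 2, p.2 ^ 2) =
      ev p (S (2 * m + 1) ⟨2 * (i : ℕ), by have := i.isLt; omega⟩) *
        ev p (S (2 * n + 1) ⟨2 * (j : ℕ), by have := j.isLt; omega⟩) := by
    simp only [hH, ev, hrel]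
    ring
  have hev_mul (p : ℝ × ℝ) (f g : MvPolynomial (Fin 2) ℝ) : ev p (f * g) = ev p f * ev p g :=
    map_mul _ f g
  simp only [hev_mul, ← hHS] at hint hzero
  rw [← integrable_indicator_iff hW.1] at hint
  rw [← integral_indicator hW.1, integral_eq_four_mul_quadrant hint] at hzero
  · rw [setIntegral_indicator hW.1, Set.inter_comm, ← setIntegral_Ωstar_mul_W00 hW.1] at hzero
    have h := (mul_eq_zero.mp hzero).resolve_left four_ne_zero
    simpa only [hH, mul_assoc] using h
  · intro p
    by_cases hp : p ∈ Ω
    · rw [Set.indicator_of_mem hp, Set.indicator_of_mem ((hsym.abs_mem_iff p).mpr hp),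
        hsym.weight_abs hp]
      simp only [sq_abs]
    · rw [Set.indicator_of_notMem hp,
        Set.indicator_of_notMem (mt (hsym.abs_mem_iff p).mp hp)]
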